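/- Let 0 < α ≤ 1/2, let f ∈ 𝒜_α, and let λ ∈ ℂ with 1 < |λ| ≤ 2. Then the function z ↦ f(z)/(z − λ) belongs to 𝒜_α and ‖f/(·−λ)‖_{𝒜_α} ≤ ‖f‖_{𝒜_α} · Σ_{n≥0} ‖z^n‖_{𝒜_α} |λ|^{−n−1} ≤ C ‖f‖_{𝒜_α} / (|λ|−1)^{3/2}, where C > 0 depends only on α. -/

import Mathlib

open Complex MeasureTheory Set Metric Filter
open scoped ENNReal Classical

noncomputable section

/-- The open unit disc in `ℂ`. -/
def uDisc : Set ℂ := Metric.ball 0 1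

/-- The unit circle in `ℂ`. -/
def uCircle : Set ℂ := Metric.sphere (0 : ℂ) 1

/-- `f` is analytic on the open unit disc and continuous on the closed unit disc. -/
def IsDiscReg (f : ℂ → ℂ) : Prop :=
  DifferentiableOn ℂ f uDisc ∧ ContinuousOn f (Metric.closedBall 0 1)

/-- The little-o Lipschitz condition of order `α` on the closed unit disc:
`|f z - f w| = o(|z-w|^α)` as `|z - w| → 0`. -/
def LittleLip (α : ℝ) (f : ℂ → ℂ) : Prop :=
  ∀ ε > 0, ∃ δ > 0, ∀ z ∈ Metric.closedBall (0 : ℂ) 1, ∀ w ∈ Metric.closedBall (0 : ℂ) 1,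
    ‖z - w‖ < δ → ‖f z - f w‖ ≤ ε * ‖z - w‖ ^ α

/-- Membership in `lip_α`. -/
def MemLip (α : ℝ) (f : ℂ → ℂ) : Prop := IsDiscReg f ∧ LittleLip α f

/-- The Dirichlet integral `D(f) = ∫_𝔻 |f'|² dA` with respect to the normalized
area measure `dA = (1/π)·(Lebesgue)`. -/
def dirInt (f : ℂ → ℂ) : ℝ := (1 / Real.pi) * ∫ z in uDisc, ‖deriv f z‖ ^ 2

/-- Membership in the Dirichlet space `𝒟`. -/
def MemDir (f : ℂ → ℂ) : Prop :=
  DifferentiableOn ℂ f uDisc ∧ IntegrableOn (fun z => ‖deriv f z‖ ^ 2) uDisc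

/-- Sup norm over the unit disc. -/
def supNorm (f : ℂ → ℂ) : ℝ := sSup ((fun z => ‖f z‖) '' uDisc)

/-- The `lip_α` norm `‖f‖_α = ‖f‖_∞ + sup_{z∈𝔻} (1-|z|)^{1-α}|f'(z)|`. -/
def lipNorm (α : ℝ) (f : ℂ → ℂ) : ℝ :=
  supNorm f + sSup ((fun z => (1 - ‖z‖) ^ (1 - α) * ‖deriv f z‖) '' uDisc)

/-- The `𝒜_α` norm `‖f‖_{𝒜_α} = ‖f‖_α + D(f)^{1/2}`. -/
def ANorm (α : ℝ) (f : ℂ → ℂ) : ℝ := lipNorm α f + Real.sqrt (dirInt f)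

/-- Membership in `𝒜_α = 𝒟 ∩ lip_α`. -/
def MemA (α : ℝ) (f : ℂ → ℂ) : Prop := MemDir f ∧ MemLip α f

/-- A closed ideal of the Banach algebra `𝒜_α`, encoded as a set of functions `ℂ → ℂ`
(two functions agreeing on the closed disc represent the same element of `𝒜_α`). -/
structure IsClosedIdeal (α : ℝ) (J : Set (ℂ → ℂ)) : Prop where
  mem_A : ∀ f ∈ J, MemA α f
  zero_mem : (0 : ℂ → ℂ) ∈ J
  add_mem : ∀ f ∈ J, ∀ g ∈ J, f + g ∈ J
  smul_mem : ∀ (c : ℂ), ∀ f ∈ J, c • f ∈ J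
  mul_mem : ∀ f ∈ J, ∀ g : ℂ → ℂ, MemA α g → f * g ∈ J
  ext_mem : ∀ f ∈ J, ∀ g : ℂ → ℂ, MemA α g →
    (∀ z ∈ Metric.closedBall (0 : ℂ) 1, g z = f z) → g ∈ J
  closed : ∀ (F : ℕ → ℂ → ℂ) (f : ℂ → ℂ), (∀ n, F n ∈ J) → MemA α f →
    Tendsto (fun n => ANorm α (F n - f)) atTop (nhds 0) → f ∈ J

/-- The boundary zero set `E_f = {ξ ∈ 𝕋 : f ξ = 0}`. -/
def bZeros (f : ℂ → ℂ) : Set ℂ := {ξ | ξ ∈ uCircle ∧ f ξ = 0}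

/-- An inner function: bounded analytic on `𝔻` with radial limits of modulus `1`
at almost every point of `𝕋`. -/
def IsInner (U : ℂ → ℂ) : Prop :=
  DifferentiableOn ℂ U uDisc ∧ (∀ z ∈ uDisc, ‖U z‖ ≤ 1) ∧
    ∀ᵐ θ : ℝ, Tendsto (fun r : ℝ => ‖U ((r : ℂ) * Complex.exp ((θ : ℂ) * Complex.I))‖)
      (nhdsWithin 1 (Set.Iio 1)) (nhds 1)

/-- The Schwarz/Herglotz kernel `(e^{iθ}+z)/(e^{iθ}-z)`. -/
def circleKernel (z : ℂ) (θ : ℝ) : ℂ :=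
  (Complex.exp ((θ : ℂ) * Complex.I) + z) / (Complex.exp ((θ : ℂ) * Complex.I) - z)

/-- `f` is an outer function. -/
def IsOuter (f : ℂ → ℂ) : Prop :=
  IsDiscReg f ∧ (∃ z ∈ uDisc, f z ≠ 0) ∧
    ∀ z ∈ uDisc, f z = Complex.exp ((1 / (2 * (Real.pi : ℂ))) *
      ∫ θ in (0:ℝ)..(2 * Real.pi),
        circleKernel z θ * (Real.log ‖f (Complex.exp ((θ : ℂ) * Complex.I))‖ : ℂ))

/-- The outer power `f^ρ`, the outer function with boundary modulus `|f|^ρ`. -/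
def outerPow (f : ℂ → ℂ) (ρ : ℝ) (z : ℂ) : ℂ :=
  Complex.exp (((ρ : ℂ) / (2 * (Real.pi : ℂ))) *
    ∫ θ in (0:ℝ)..(2 * Real.pi),
      circleKernel z θ * (Real.log ‖f (Complex.exp ((θ : ℂ) * Complex.I))‖ : ℂ))

/-- The set of angles in `[0, 2π)` whose corresponding point of the circle lies in `A`. -/
def angSet (A : Set ℂ) : Set ℝ :=
  {θ | θ ∈ Set.Ico (0 : ℝ) (2 * Real.pi) ∧ Complex.exp ((θ : ℂ) * Complex.I) ∈ A}

/-- The outer factor `f_Γ` associated with a boundary set `Γ ⊆ 𝕋`. -/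
def outerPart (f : ℂ → ℂ) (Γ : Set ℂ) (z : ℂ) : ℂ :=
  Complex.exp ((1 / (2 * (Real.pi : ℂ))) *
    ∫ θ in angSet Γ, circleKernel z θ * (Real.log ‖f (Complex.exp ((θ : ℂ) * Complex.I))‖ : ℂ))

/-- `𝕋 \ E_f`, the set of boundary points where `f` does not vanish. -/
def offZeros (f : ℂ → ℂ) : Set ℂ := {ξ | ξ ∈ uCircle ∧ f ξ ≠ 0}

/-- `γ` is a component arc (connected component) of `𝕋 \ E_f`. -/
def IsCompArc (f : ℂ → ℂ) (γ : Set ℂ) : Prop :=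
  ∃ x ∈ offZeros f, γ = connectedComponentIn (offZeros f) x

/-- `Γ` is a union of component arcs of `𝕋 \ E_f`. -/
def IsArcUnion (f : ℂ → ℂ) (Γ : Set ℂ) : Prop :=
  Γ ⊆ offZeros f ∧ ∀ x ∈ Γ, connectedComponentIn (offZeros f) x ⊆ Γ

/-- The sector `Δ_γ = {z ∈ 𝔻 : z/|z| ∈ γ}`. -/
def discSector (γ : Set ℂ) : Set ℂ := {z | z ∈ uDisc ∧ ((‖z‖ : ℂ))⁻¹ * z ∈ γ}

/-- Lower integral of `g` over `S` with respect to the normalized area measure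
`dA = (1/π)·(Lebesgue)`. -/
def nlint (S : Set ℂ) (g : ℂ → ℝ) : ℝ≥0∞ :=
  ENNReal.ofReal (1 / Real.pi) * ∫⁻ z in S, ENNReal.ofReal (g z)

/-- `d(z) = min(|z-a|, |z-b|)`, distance to the endpoints of the arc `γ = (a,b)`. -/
def dd (a b z : ℂ) : ℝ := min ‖z - a‖ ‖z - b‖

/-- `Λ_γ`: equals `Γ` if `γ ⊄ Γ`, and `𝕋 \ Γ` if `γ ⊆ Γ`. -/
def lamSet (Γ γ : Set ℂ) : Set ℂ := if γ ⊆ Γ then uCircle \ Γ else Γ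

/-- The function `a_γ(z) = (1/2π)∫_{Λ_γ} (−log|f(e^{iθ})|)/|e^{iθ}−z|² dθ`. -/
def aFun (f : ℂ → ℂ) (Γ γ : Set ℂ) (z : ℂ) : ℝ :=
  (1 / (2 * Real.pi)) * ∫ θ in angSet (lamSet Γ γ),
    (-(Real.log ‖f (Complex.exp ((θ : ℂ) * Complex.I))‖)) /
      ‖Complex.exp ((θ : ℂ) * Complex.I) - z‖ ^ 2

/-- `Δ_γ¹ = {z ∈ Δ_γ : d(z) < 2(1−|z|)}`. -/
def sector1 (a b : ℂ) (γ : Set ℂ) : Set ℂ :=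
  {z | z ∈ discSector γ ∧ dd a b z < 2 * (1 - ‖z‖)}

/-- `Δ_γ² = {z ∈ Δ_γ : d(z) ≥ 2(1−|z|)}`. -/
def sector2 (a b : ℂ) (γ : Set ℂ) : Set ℂ :=
  {z | z ∈ discSector γ ∧ 2 * (1 - ‖z‖) ≤ dd a b z}

/-- `Δ_γ²¹ = {z ∈ Δ_γ² : a_γ(z) ≤ 8|log d(z)|/d(z)}`. -/
def sector21 (f : ℂ → ℂ) (Γ γ : Set ℂ) (a b : ℂ) : Set ℂ :=
  {z | z ∈ sector2 a b γ ∧ aFun f Γ γ z ≤ 8 * |Real.log (dd a b z)| / dd a b z}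

/-- `Δ_γ²² = {z ∈ Δ_γ² : 8|log d(z)|/d(z) < a_γ(z) < 8|log d(z)|/(1−|z|)}`. -/
def sector22 (f : ℂ → ℂ) (Γ γ : Set ℂ) (a b : ℂ) : Set ℂ :=
  {z | z ∈ sector2 a b γ ∧ 8 * |Real.log (dd a b z)| / dd a b z < aFun f Γ γ z ∧
    aFun f Γ γ z < 8 * |Real.log (dd a b z)| / (1 - ‖z‖)}

/-- `Δ_γ²³ = {z ∈ Δ_γ² : a_γ(z) ≥ 8|log d(z)|/(1−|z|)}`. -/
def sector23 (f : ℂ → ℂ) (Γ γ : Set ℂ) (a b : ℂ) : Set ℂ :=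
  {z | z ∈ sector2 a b γ ∧ 8 * |Real.log (dd a b z)| / (1 - ‖z‖) ≤ aFun f Γ γ z}

/-- `μ_z = 1 − 8|log d(z)|/a_γ(z)`. -/
def muOf (f : ℂ → ℂ) (Γ γ : Set ℂ) (a b : ℂ) (z : ℂ) : ℝ :=
  1 - 8 * |Real.log (dd a b z)| / aFun f Γ γ z

/-- The tail union `Γ_m = ⋃_{p ≥ m} γ_p`. -/
def tailUnion (γ : ℕ → Set ℂ) (m : ℕ) : Set ℂ := ⋃ p ∈ Set.Ici m, γ p

end

lemma zero_mem_uDisc : (0 : ℂ) ∈ uDisc := by simp [uDisc]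

lemma norm_lt_one_of_mem_uDisc {z : ℂ} (hz : z ∈ uDisc) : ‖z‖ < 1 := by
  simpa [uDisc] using hz

lemma supNorm_nonneg (f : ℂ → ℂ) : 0 ≤ supNorm f := by
  apply Real.sSup_nonneg
  rintro _ ⟨z, -, rfl⟩
  exact norm_nonneg _

/-- The seminorm `sup_{z∈𝔻} (1-|z|)^{1-α}|f'(z)|`. -/
noncomputable def lipSemi (α : ℝ) (f : ℂ → ℂ) : ℝ :=
  sSup ((fun z => (1 - ‖z‖) ^ (1 - α) * ‖deriv f z‖) '' uDisc)

lemma lipSemi_nonneg (α : ℝ) (f : ℂ → ℂ) : 0 ≤ lipSemi α f := by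
  apply Real.sSup_nonneg
  rintro _ ⟨z, hz, rfl⟩
  have := norm_lt_one_of_mem_uDisc hz
  exact mul_nonneg (Real.rpow_nonneg (by linarith) _) (norm_nonneg _)

lemma ANorm_eq (α : ℝ) (f : ℂ → ℂ) :
    ANorm α f = supNorm f + lipSemi α f + Real.sqrt (dirInt f) := rfl

lemma ANorm_nonneg (α : ℝ) (f : ℂ → ℂ) : 0 ≤ ANorm α f := by
  rw [ANorm_eq]
  have := supNorm_nonneg f
  have := lipSemi_nonneg α f
  positivity

lemma supNorm_le {f : ℂ → ℂ} {A : ℝ} (h : ∀ z ∈ uDisc, ‖f z‖ ≤ A) : supNorm f ≤ A := by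
  apply csSup_le (Set.Nonempty.image _ ⟨0, zero_mem_uDisc⟩)
  rintro _ ⟨z, hz, rfl⟩
  exact h z hz

lemma lipSemi_le {α : ℝ} {f : ℂ → ℂ} {B : ℝ}
    (h : ∀ z ∈ uDisc, (1 - ‖z‖) ^ (1 - α) * ‖deriv f z‖ ≤ B) : lipSemi α f ≤ B := by
  apply csSup_le (Set.Nonempty.image _ ⟨0, zero_mem_uDisc⟩)
  rintro _ ⟨z, hz, rfl⟩
  exact h z hz

lemma le_supNorm_of_bound {f : ℂ → ℂ} {A : ℝ} (h : ∀ z ∈ uDisc, ‖f z‖ ≤ A)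
    {z : ℂ} (hz : z ∈ uDisc) : ‖f z‖ ≤ supNorm f := by
  refine le_csSup ⟨A, ?_⟩ ⟨z, hz, rfl⟩
  rintro _ ⟨z, hz, rfl⟩
  exact h z hz

lemma le_lipSemi_of_bound {α : ℝ} {f : ℂ → ℂ} {B : ℝ}
    (h : ∀ z ∈ uDisc, (1 - ‖z‖) ^ (1 - α) * ‖deriv f z‖ ≤ B)
    {z : ℂ} (hz : z ∈ uDisc) : (1 - ‖z‖) ^ (1 - α) * ‖deriv f z‖ ≤ lipSemi α f := by
  refine le_csSup ⟨B, ?_⟩ ⟨z, hz, rfl⟩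
  rintro _ ⟨z, hz, rfl⟩
  exact h z hz

lemma IsDiscReg.exists_bound {f : ℂ → ℂ} (hf : IsDiscReg f) :
    ∃ M, 0 ≤ M ∧ ∀ z ∈ Metric.closedBall (0 : ℂ) 1, ‖f z‖ ≤ M := by
  obtain ⟨M, hM⟩ := (isCompact_closedBall (0 : ℂ) 1).exists_bound_of_continuousOn hf.2
  exact ⟨M, (norm_nonneg _).trans (hM 0 (by simp)), hM⟩

lemma IsDiscReg.norm_le_supNorm {f : ℂ → ℂ} (hf : IsDiscReg f) {z : ℂ} (hz : z ∈ uDisc) :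
    ‖f z‖ ≤ supNorm f := by
  obtain ⟨M, -, hM⟩ := hf.exists_bound
  exact le_supNorm_of_bound (fun w hw => hM w (Metric.ball_subset_closedBall hw)) hz

/-- A little-Lipschitz function satisfies a global Hölder estimate. -/
lemma MemLip.exists_holder {α : ℝ} (hα : 0 < α) {f : ℂ → ℂ} (hf : MemLip α f) :
    ∃ K, 0 ≤ K ∧ ∀ z ∈ Metric.closedBall (0 : ℂ) 1, ∀ w ∈ Metric.closedBall (0 : ℂ) 1,
      ‖f z - f w‖ ≤ K * ‖z - w‖ ^ α := by
  obtain ⟨M, hM0, hM⟩ := hf.1.exists_bound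
  obtain ⟨δ, hδ, h⟩ := hf.2 1 one_pos
  refine ⟨1 + 2 * M / δ ^ α, by positivity, fun z hz w hw => ?_⟩
  have hp : 0 ≤ ‖z - w‖ ^ α := by positivity
  rcases lt_or_ge ‖z - w‖ δ with hlt | hge
  · refine (h z hz w hw hlt).trans (mul_le_mul_of_nonneg_right ?_ hp)
    have : 0 ≤ 2 * M / δ ^ α := by positivity
    linarith
  · have h1 : ‖f z - f w‖ ≤ 2 * M := by
      have := norm_sub_le (f z) (f w)
      linarith [hM z hz, hM w hw]
    have h2 : δ ^ α ≤ ‖z - w‖ ^ α := Real.rpow_le_rpow hδ.le hge hα.le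
    have hd : 0 < δ ^ α := by positivity
    have h3 : 2 * M ≤ 2 * M / δ ^ α * ‖z - w‖ ^ α := by
      calc 2 * M = 2 * M / δ ^ α * δ ^ α := by field_simp
        _ ≤ _ := by gcongr
    nlinarith

lemma MemLip.exists_deriv_bound {α : ℝ} (hα : 0 < α) {f : ℂ → ℂ} (hf : MemLip α f) :
    ∃ K, ∀ z ∈ uDisc, (1 - ‖z‖) ^ (1 - α) * ‖deriv f z‖ ≤ K := by
  obtain ⟨K, hK0, hK⟩ := hf.exists_holder hα
  refine ⟨K, fun z hz => ?_⟩
  have hz1 := norm_lt_one_of_mem_uDisc hz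
  have hR : 0 < 1 - ‖z‖ := by linarith
  have hsub : Metric.ball z (1 - ‖z‖) ⊆ uDisc :=
    Metric.ball_subset_ball' (by simp)
  have hsub' : Metric.closedBall z (1 - ‖z‖) ⊆ Metric.closedBall 0 1 :=
    Metric.closedBall_subset_closedBall' (by simp)
  have hd : DiffContOnCl ℂ (fun w => f w - f z) (Metric.ball z (1 - ‖z‖)) := by
    refine ⟨(hf.1.1.mono hsub).sub_const _, ?_⟩
    rw [closure_ball _ hR.ne']
    exact (hf.1.2.mono hsub').sub continuousOn_const
  have h := Complex.norm_deriv_le_of_forall_mem_sphere_norm_le (C := K * (1 - ‖z‖) ^ α) hR hd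
    (fun w hw => by
      have := hK w (hsub' (Metric.sphere_subset_closedBall hw)) z (Metric.ball_subset_closedBall hz)
      rwa [mem_sphere_iff_norm.1 hw] at this)
  rw [deriv_sub_const] at h
  calc (1 - ‖z‖) ^ (1 - α) * ‖deriv f z‖
      ≤ (1 - ‖z‖) ^ (1 - α) * (K * (1 - ‖z‖) ^ α / (1 - ‖z‖)) := by gcongr
    _ = K * ((1 - ‖z‖) ^ (1 - α) * (1 - ‖z‖) ^ α) / (1 - ‖z‖) := by ring
    _ = K := by
      rw [← Real.rpow_add hR, sub_add_cancel, Real.rpow_one]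
      field_simp

/-- A little-Lipschitz function times a bounded Lipschitz function is little-Lipschitz. -/
lemma LittleLip.mul_lipschitz {α : ℝ} (hα1 : α < 1) {f g : ℂ → ℂ} (hf : LittleLip α f)
    {M A L : ℝ} (hM0 : 0 ≤ M) (hA0 : 0 ≤ A) (hL0 : 0 ≤ L)
    (hM : ∀ z ∈ Metric.closedBall (0 : ℂ) 1, ‖f z‖ ≤ M)
    (hA : ∀ z ∈ Metric.closedBall (0 : ℂ) 1, ‖g z‖ ≤ A)
    (hL : ∀ z ∈ Metric.closedBall (0 : ℂ) 1, ∀ w ∈ Metric.closedBall (0 : ℂ) 1,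
      ‖g z - g w‖ ≤ L * ‖z - w‖) :
    LittleLip α (fun z => f z * g z) := by
  intro ε hε
  obtain ⟨δ, hδ, h⟩ := hf (ε / (2 * (A + 1))) (by positivity)
  have hb : 0 < 1 - α := by linarith
  set η := (ε / (2 * (M * L + 1))) ^ (1 - α)⁻¹ with hη
  have hη0 : 0 < η := by positivity
  refine ⟨min δ η, lt_min hδ hη0, fun z hz w hw hzw => ?_⟩
  have h1 := h z hz w hw (hzw.trans_le (min_le_left _ _))
  have h2 := hL z hz w hw
  have hlt : ‖z - w‖ < η := hzw.trans_le (min_le_right _ _)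
  set t := ‖z - w‖
  have ht0 : 0 ≤ t := norm_nonneg _
  have htα : 0 ≤ t ^ α := by positivity
  have h3 : t ^ (1 - α) ≤ ε / (2 * (M * L + 1)) := by
    calc t ^ (1 - α) ≤ η ^ (1 - α) := Real.rpow_le_rpow ht0 hlt.le hb.le
      _ = _ := by rw [hη, Real.rpow_inv_rpow (by positivity) hb.ne']
  have h4 : t = t ^ α * t ^ (1 - α) := by
    rcases ht0.eq_or_lt with h0 | h0
    · rw [← h0, Real.zero_rpow hb.ne', mul_zero]
    · rw [← Real.rpow_add h0]; simp
  have e : f z * g z - f w * g w = (f z - f w) * g z + f w * (g z - g w) := by ring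
  calc ‖f z * g z - f w * g w‖ ≤ ‖f z - f w‖ * ‖g z‖ + ‖f w‖ * ‖g z - g w‖ := by
        rw [e]; exact (norm_add_le _ _).trans (by simp)
    _ ≤ (ε / (2 * (A + 1)) * t ^ α) * A + M * (L * t) := by
        gcongr
        · exact hA z hz
        · exact hM w hw
    _ = (ε / (2 * (A + 1)) * A) * t ^ α + (M * L) * t := by ring
    _ ≤ ε / 2 * t ^ α + ε / 2 * t ^ α := by
        gcongr ?_ * _ + ?_
        · rw [div_mul_eq_mul_div, div_le_div_iff₀ (by positivity) (by positivity)]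
          nlinarith
        · calc (M * L) * t = (M * L) * t ^ (1 - α) * t ^ α := by
                conv_lhs => rw [h4]
                ring
            _ ≤ (M * L) * (ε / (2 * (M * L + 1))) * t ^ α := by gcongr
            _ ≤ _ := by
                gcongr
                have : 0 ≤ M * L := by positivity
                rw [← mul_div_assoc, div_le_div_iff₀ (by positivity) (by positivity)]
                nlinarith
    _ = ε * t ^ α := by ring

/-- Lebesgue measure restricted to the unit disc. -/
noncomputable abbrev discMeasure : Measure ℂ := volume.restrict uDisc

instance : IsFiniteMeasure discMeasure :=
  ⟨by simp [discMeasure, uDisc]⟩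

lemma aestronglyMeasurable_deriv_disc (f : ℂ → ℂ) :
    AEStronglyMeasurable (deriv f) discMeasure :=
  (measurable_deriv f).aestronglyMeasurable

lemma memLp_deriv_iff (f : ℂ → ℂ) :
    MemLp (deriv f) 2 discMeasure ↔ IntegrableOn (fun z => ‖deriv f z‖ ^ 2) uDisc :=
  memLp_two_iff_integrable_sq_norm (aestronglyMeasurable_deriv_disc f)

lemma sqrt_dirInt (f : ℂ → ℂ) :
    Real.sqrt (dirInt f) = Real.sqrt (1 / Real.pi) * lpNorm (deriv f) 2 discMeasure := by
  rw [dirInt, Real.sqrt_mul (by positivity),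
    lpNorm_eq_integral_norm_rpow_toReal (by simp) (by simp) (aestronglyMeasurable_deriv_disc f)]
  simp [Real.sqrt_eq_rpow]

/-- Multiplicative estimate for the `𝒜_α` norm. -/
lemma ANorm_mul_le {α : ℝ} (hα : 0 < α) {f g : ℂ → ℂ} (hf : MemA α f)
    (hg : DifferentiableOn ℂ g uDisc) (hg2 : MemLp (deriv g) 2 discMeasure) {A B E : ℝ}
    (hA : ∀ z ∈ uDisc, ‖g z‖ ≤ A)
    (hB : ∀ z ∈ uDisc, (1 - ‖z‖) ^ (1 - α) * ‖deriv g z‖ ≤ B)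
    (hE : Real.sqrt (dirInt g) ≤ E) :
    MemLp (deriv (fun z => f z * g z)) 2 discMeasure ∧
      ANorm α (fun z => f z * g z) ≤ ANorm α f * (A + B + E) := by
  have hopen : IsOpen uDisc := Metric.isOpen_ball
  have hF : ∀ z ∈ uDisc, ‖f z‖ ≤ supNorm f := fun z hz => hf.2.1.norm_le_supNorm hz
  obtain ⟨K, hK⟩ := hf.2.exists_deriv_bound hα
  have hS : ∀ z ∈ uDisc, (1 - ‖z‖) ^ (1 - α) * ‖deriv f z‖ ≤ lipSemi α f :=
    fun z hz => le_lipSemi_of_bound hK hz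
  have hf2 := (memLp_deriv_iff f).2 hf.1.2
  have hA0 : 0 ≤ A := (norm_nonneg _).trans (hA 0 zero_mem_uDisc)
  have hF0 := supNorm_nonneg f
  have hS0 := lipSemi_nonneg α f
  have hB0 : 0 ≤ B := le_trans (by simp) (hB 0 zero_mem_uDisc)
  have hE0 : 0 ≤ E := (Real.sqrt_nonneg _).trans hE
  have hderiv : ∀ z ∈ uDisc, ‖deriv (fun z => f z * g z) z‖ ≤
      A * ‖deriv f z‖ + supNorm f * ‖deriv g z‖ := by
    intro z hz
    rw [deriv_fun_mul (hf.1.1.differentiableAt (hopen.mem_nhds hz))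
      (hg.differentiableAt (hopen.mem_nhds hz))]
    refine (norm_add_le _ _).trans ?_
    rw [norm_mul, norm_mul, mul_comm]
    gcongr
    · exact hA z hz
    · exact hF z hz
  set u : ℂ → ℝ := fun z => A * ‖deriv f z‖
  set v : ℂ → ℝ := fun z => supNorm f * ‖deriv g z‖
  have hu : MemLp u 2 discMeasure := hf2.norm.const_mul A
  have hv : MemLp v 2 discMeasure := hg2.norm.const_mul _
  have hae : ∀ᵐ z ∂discMeasure, ‖deriv (fun z => f z * g z) z‖ ≤ ‖(u + v) z‖ := by
    filter_upwards [ae_restrict_mem hopen.measurableSet] with z hz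
    exact (hderiv z hz).trans (le_abs_self _)
  have hLp : MemLp (deriv (fun z => f z * g z)) 2 discMeasure :=
    (hu.add hv).mono (aestronglyMeasurable_deriv_disc _) hae
  refine ⟨hLp, ?_⟩
  have hnu : lpNorm u 2 discMeasure = A * lpNorm (deriv f) 2 discMeasure := by
    have : u = A • fun z => ‖deriv f z‖ := rfl
    rw [this, lpNorm_const_smul, lpNorm_norm (aestronglyMeasurable_deriv_disc f)]
    simp [abs_of_nonneg hA0]
  have hnv : lpNorm v 2 discMeasure = supNorm f * lpNorm (deriv g) 2 discMeasure := by
    have : v = supNorm f • fun z => ‖deriv g z‖ := rfl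
    rw [this, lpNorm_const_smul, lpNorm_norm (aestronglyMeasurable_deriv_disc g)]
    simp [abs_of_nonneg hF0]
  have hL : lpNorm (deriv (fun z => f z * g z)) 2 discMeasure ≤
      A * lpNorm (deriv f) 2 discMeasure + supNorm f * lpNorm (deriv g) 2 discMeasure := by
    rw [← hnu, ← hnv]
    refine le_trans ?_ (lpNorm_add_le hu (by norm_num))
    rw [← toReal_eLpNorm hLp.1, ← toReal_eLpNorm (hu.add hv).1]
    exact ENNReal.toReal_mono (hu.add hv).eLpNorm_ne_top (eLpNorm_mono_ae hae)
  have h1 : supNorm (fun z => f z * g z) ≤ supNorm f * A := supNorm_le fun z hz => by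
    rw [norm_mul]
    gcongr
    · exact hF z hz
    · exact hA z hz
  have h2 : lipSemi α (fun z => f z * g z) ≤ A * lipSemi α f + supNorm f * B :=
    lipSemi_le fun z hz => by
      have hz1 := norm_lt_one_of_mem_uDisc hz
      have : 0 ≤ (1 - ‖z‖) ^ (1 - α) := Real.rpow_nonneg (by linarith) _
      calc _ ≤ (1 - ‖z‖) ^ (1 - α) * (A * ‖deriv f z‖ + supNorm f * ‖deriv g z‖) := by
            gcongr; exact hderiv z hz
        _ = A * ((1 - ‖z‖) ^ (1 - α) * ‖deriv f z‖)
            + supNorm f * ((1 - ‖z‖) ^ (1 - α) * ‖deriv g z‖) := by ring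
        _ ≤ _ := by
            gcongr
            · exact hS z hz
            · exact hB z hz
  have h3 : Real.sqrt (dirInt (fun z => f z * g z)) ≤
      A * Real.sqrt (dirInt f) + supNorm f * E := by
    refine le_trans ?_ (add_le_add_right (mul_le_mul_of_nonneg_left hE hF0) _)
    rw [sqrt_dirInt, sqrt_dirInt, sqrt_dirInt]
    refine (mul_le_mul_of_nonneg_left hL (Real.sqrt_nonneg _)).trans_eq ?_
    ring
  rw [ANorm_eq, ANorm_eq]
  have hD0 := Real.sqrt_nonneg (dirInt f)
  nlinarith [mul_nonneg hS0 hB0, mul_nonneg hS0 hE0, mul_nonneg hD0 hB0, mul_nonneg hD0 hE0]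

lemma deriv_monomial (n : ℕ) :
    deriv (fun z : ℂ => z ^ n) = fun z => (n : ℂ) * z ^ (n - 1) := by
  ext z
  simp

lemma monomial_deriv_bound {α : ℝ} (hα1 : α ≤ 1 / 2) (n : ℕ) {z : ℂ} (hz : z ∈ uDisc) :
    (1 - ‖z‖) ^ (1 - α) * ‖deriv (fun z : ℂ => z ^ n) z‖ ≤ Real.sqrt n := by
  have hz1 := norm_lt_one_of_mem_uDisc hz
  have hr0 := norm_nonneg z
  rw [deriv_monomial, norm_mul, norm_pow, Complex.norm_natCast]
  set r := ‖z‖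
  have hgeom : (n : ℝ) * r ^ (n - 1) * (1 - r) ≤ 1 := by
    have h1 : (n : ℝ) * r ^ (n - 1) ≤ ∑ k ∈ Finset.range n, r ^ k := by
      have := Finset.card_nsmul_le_sum (Finset.range n) (fun k => r ^ k) (r ^ (n - 1))
        (fun k hk => pow_le_pow_of_le_one hr0 hz1.le (by have := Finset.mem_range.1 hk; omega))
      simpa using this
    calc (n : ℝ) * r ^ (n - 1) * (1 - r) ≤ (∑ k ∈ Finset.range n, r ^ k) * (1 - r) := by
          gcongr
      _ = 1 - r ^ n := geom_sum_mul_neg r n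
      _ ≤ 1 := by linarith [pow_nonneg hr0 n]
  have hpow : (1 - r) ^ (1 - α) ≤ Real.sqrt (1 - r) := by
    rw [Real.sqrt_eq_rpow]
    exact Real.rpow_le_rpow_of_exponent_ge (by linarith) (by linarith) (by linarith)
  have hp1 : r ^ (n - 1) ≤ 1 := pow_le_one₀ hr0 hz1.le
  have hp0 : 0 ≤ r ^ (n - 1) := by positivity
  calc (1 - r) ^ (1 - α) * (n * r ^ (n - 1)) ≤ Real.sqrt (1 - r) * (n * r ^ (n - 1)) := by gcongr
    _ ≤ Real.sqrt n := by
      apply Real.le_sqrt_of_sq_le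
      rw [mul_pow, Real.sq_sqrt (by linarith)]
      calc (1 - r) * (n * r ^ (n - 1)) ^ 2
          = ((n : ℝ) * r ^ (n - 1) * (1 - r)) * (n * r ^ (n - 1)) := by ring
        _ ≤ 1 * (n * 1) := by gcongr
        _ = n := by ring

lemma dirInt_monomial (n : ℕ) : dirInt (fun z : ℂ => z ^ n) = n := by
  rcases Nat.eq_zero_or_pos n with rfl | hn
  · simp [dirInt]
  have h1 : ∀ z : ℂ, uDisc.indicator (fun z => ‖deriv (fun z : ℂ => z ^ n) z‖ ^ 2) z =
      (Set.Iio (1 : ℝ)).indicator (fun r => ((n : ℝ) * r ^ (n - 1)) ^ 2) ‖z‖ := by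
    intro z
    rw [deriv_monomial]
    by_cases hz : ‖z‖ < 1 <;> simp [Set.indicator, uDisc, hz]
  have hmeas : MeasurableSet uDisc := Metric.isOpen_ball.measurableSet
  rw [dirInt, ← integral_indicator hmeas, integral_congr_ae (ae_of_all _ h1),
    integral_fun_norm_addHaar volume
      ((Set.Iio (1 : ℝ)).indicator (fun r => ((n : ℝ) * r ^ (n - 1)) ^ 2))]
  have h2 : ∀ y : ℝ, y ^ (Module.finrank ℝ ℂ - 1) •
      (Set.Iio (1 : ℝ)).indicator (fun r => ((n : ℝ) * r ^ (n - 1)) ^ 2) y =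
      (Set.Iio (1 : ℝ)).indicator (fun r => (n : ℝ) ^ 2 * r ^ (2 * n - 1)) y := by
    intro y
    by_cases hy : y < 1
    · simp only [Set.indicator, Set.mem_Iio, hy, if_true, Complex.finrank_real_complex, smul_eq_mul]
      obtain ⟨m, rfl⟩ : ∃ m, n = m + 1 := ⟨n - 1, by omega⟩
      rw [show 2 * (m + 1) - 1 = 2 * m + 1 by omega]
      simp only [Nat.add_sub_cancel]
      ring
    · simp [Set.indicator, hy]
  have h3 : ∫ r in Set.Ioo (0 : ℝ) 1, (n : ℝ) ^ 2 * r ^ (2 * n - 1) = n / 2 := by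
    rw [← integral_Ioc_eq_integral_Ioo, ← intervalIntegral.integral_of_le zero_le_one,
      intervalIntegral.integral_const_mul, integral_pow]
    have : ((2 * n - 1 : ℕ) : ℝ) + 1 = 2 * n := by
      rw [Nat.cast_sub (by omega)]; push_cast; ring
    rw [this, show 2 * n - 1 + 1 = 2 * n by omega]
    have hn' : (n : ℝ) ≠ 0 := by positivity
    rw [zero_pow (by omega)]
    field_simp
    simp
  rw [integral_congr_ae (ae_of_all _ h2), setIntegral_indicator measurableSet_Iio,
    Set.Ioi_inter_Iio, h3, Complex.finrank_real_complex, measureReal_def, Complex.volume_ball]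
  simp
  field_simp

lemma memLp_deriv_monomial (n : ℕ) : MemLp (deriv (fun z : ℂ => z ^ n)) 2 discMeasure := by
  refine MemLp.of_bound (aestronglyMeasurable_deriv_disc _) n ?_
  filter_upwards [ae_restrict_mem Metric.isOpen_ball.measurableSet] with z hz
  have hz1 := norm_lt_one_of_mem_uDisc hz
  rw [deriv_monomial, norm_mul, norm_pow, Complex.norm_natCast]
  exact mul_le_of_le_one_right (by positivity) (pow_le_one₀ (norm_nonneg z) hz1.le)

lemma norm_monomial_le_one (n : ℕ) {z : ℂ} (hz : z ∈ uDisc) : ‖z ^ n‖ ≤ 1 := by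
  rw [norm_pow]
  exact pow_le_one₀ (norm_nonneg z) (norm_lt_one_of_mem_uDisc hz).le

lemma ANorm_monomial_le {α : ℝ} (hα1 : α ≤ 1 / 2) (n : ℕ) :
    ANorm α (fun z : ℂ => z ^ n) ≤ 1 + 2 * Real.sqrt n := by
  rw [ANorm_eq, dirInt_monomial]
  have h1 : supNorm (fun z : ℂ => z ^ n) ≤ 1 := supNorm_le fun z => norm_monomial_le_one n
  have h2 : lipSemi α (fun z : ℂ => z ^ n) ≤ Real.sqrt n :=
    lipSemi_le fun z => monomial_deriv_bound hα1 n
  linarith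

lemma tsum_one_add_two_sqrt_mul_pow_le {x : ℝ} (hx0 : 0 < x) (hx1 : x < 1) :
    Summable (fun n : ℕ => (1 + 2 * Real.sqrt n) * x ^ (n + 1)) ∧
      ∑' n : ℕ, (1 + 2 * Real.sqrt n) * x ^ (n + 1) ≤ 3 * (1 - x) ^ (-(3 / 2) : ℝ) := by
  have h0 : 0 < 1 - x := by linarith
  set t := Real.sqrt (1 - x) with ht
  have ht0 : 0 < t := Real.sqrt_pos.2 h0
  have ht2 : t ^ 2 = 1 - x := Real.sq_sqrt h0.le
  have ht1 : t ≤ 1 := Real.sqrt_le_one.2 (by linarith)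
  have hxn : ‖x‖ < 1 := by rwa [Real.norm_of_nonneg hx0.le]
  have hs : HasSum (fun n : ℕ => x * (1 + t⁻¹) * x ^ n + x * t * (n * x ^ n))
      (x * (1 + t⁻¹) * (1 - x)⁻¹ + x * t * (x / (1 - x) ^ 2)) :=
    ((hasSum_geometric_of_lt_one hx0.le hx1).mul_left _).add
      ((hasSum_coe_mul_geometric_of_norm_lt_one hxn).mul_left _)
  have hle : ∀ n : ℕ, (1 + 2 * Real.sqrt n) * x ^ (n + 1) ≤
      x * (1 + t⁻¹) * x ^ n + x * t * (n * x ^ n) := by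
    intro n
    have hsq : Real.sqrt n ^ 2 = n := Real.sq_sqrt (Nat.cast_nonneg n)
    have h : 2 * Real.sqrt n ≤ t⁻¹ + n * t := by
      have hexp : t⁻¹ + Real.sqrt n ^ 2 * t - 2 * Real.sqrt n = t⁻¹ * (1 - t * Real.sqrt n) ^ 2 := by
        field_simp
        ring
      have hpos : 0 ≤ t⁻¹ * (1 - t * Real.sqrt n) ^ 2 := by positivity
      rw [hsq] at hexp
      linarith
    calc (1 + 2 * Real.sqrt n) * x ^ (n + 1) ≤ (1 + (t⁻¹ + n * t)) * x ^ (n + 1) := by gcongr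
      _ = _ := by ring
  have hsum : Summable (fun n : ℕ => (1 + 2 * Real.sqrt n) * x ^ (n + 1)) :=
    Summable.of_nonneg_of_le (fun n => by positivity) hle hs.summable
  refine ⟨hsum, (hsum.tsum_le_tsum hle hs.summable).trans ?_⟩
  rw [hs.tsum_eq]
  have hrp : (1 - x) ^ (-(3 / 2) : ℝ) = (t ^ 3)⁻¹ := by
    rw [Real.rpow_neg h0.le, ht, Real.sqrt_eq_rpow, ← Real.rpow_natCast, ← Real.rpow_mul h0.le]
    norm_num
  rw [hrp, ← ht2]
  have e : x * (1 + t⁻¹) * (t ^ 2)⁻¹ + x * t * (x / (t ^ 2) ^ 2) =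
      (x * t + x + x * x) * (t ^ 3)⁻¹ := by
    field_simp
  rw [e]
  gcongr
  nlinarith

section Resolvent

variable {lam : ℂ}

lemma norm_sub_lower (z : ℂ) (hz : ‖z‖ ≤ 1) : ‖lam‖ - 1 ≤ ‖z - lam‖ := by
  have := norm_sub_norm_le lam z
  rw [norm_sub_rev] at this
  linarith

lemma sub_ne_zero_of_norm_lt (hl : 1 < ‖lam‖) {z : ℂ} (hz : ‖z‖ ≤ 1) : z - lam ≠ 0 := by
  have := norm_sub_lower (lam := lam) z hz
  exact norm_pos_iff.1 (by linarith)

lemma hasDerivAt_resolvent (hl : 1 < ‖lam‖) {z : ℂ} (hz : ‖z‖ ≤ 1) :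
    HasDerivAt (fun w : ℂ => (w - lam)⁻¹) (-1 / (z - lam) ^ 2) z :=
  ((hasDerivAt_id z).sub_const lam).fun_inv (sub_ne_zero_of_norm_lt hl hz)

lemma hasSum_resolvent (hl : 1 < ‖lam‖) {z : ℂ} (hz : ‖z‖ ≤ 1) :
    HasSum (fun n : ℕ => -(lam ^ (n + 1))⁻¹ * z ^ n) (z - lam)⁻¹ := by
  have hl0 : lam ≠ 0 := norm_pos_iff.1 (by linarith)
  have hw : ‖z / lam‖ < 1 := by
    rw [norm_div, div_lt_one (by linarith)]
    linarith
  have h := (hasSum_geometric_of_norm_lt_one hw).mul_left (-lam⁻¹)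
  have hterm : (fun n : ℕ => -(lam ^ (n + 1))⁻¹ * z ^ n) = fun n => -lam⁻¹ * (z / lam) ^ n := by
    ext n
    rw [div_pow]
    field_simp
    ring
  have hval : (z - lam)⁻¹ = -lam⁻¹ * (1 - z / lam)⁻¹ := by
    have h1 := sub_ne_zero_of_norm_lt hl hz
    have h2 : lam - z ≠ 0 := by rw [← neg_sub]; exact neg_ne_zero.2 h1
    have h3 : 1 - z / lam ≠ 0 := by
      rw [one_sub_div hl0]
      exact div_ne_zero h2 hl0
    field_simp
    ring
  rw [hterm, hval]
  exact h

lemma hasSum_deriv_resolvent (hl : 1 < ‖lam‖) {z : ℂ} (hz : ‖z‖ ≤ 1) :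
    HasSum (fun n : ℕ => -(lam ^ (n + 1))⁻¹ * deriv (fun w : ℂ => w ^ n) z)
      (deriv (fun w : ℂ => (w - lam)⁻¹) z) := by
  have hl0 : lam ≠ 0 := norm_pos_iff.1 (by linarith)
  have hw : ‖z / lam‖ < 1 := by
    rw [norm_div, div_lt_one (by linarith)]
    linarith
  have h := ((hasSum_coe_mul_geometric_of_norm_lt_one hw).add
    (hasSum_geometric_of_norm_lt_one hw)).mul_left (-(lam ^ 2)⁻¹)
  rw [← hasSum_nat_add_iff' 1, (hasDerivAt_resolvent hl hz).deriv]
  have hterm : (fun n : ℕ => -(lam ^ (n + 1 + 1))⁻¹ * deriv (fun w : ℂ => w ^ (n + 1)) z) =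
      fun n : ℕ => -(lam ^ 2)⁻¹ * (n * (z / lam) ^ n + (z / lam) ^ n) := by
    ext n
    rw [deriv_monomial, div_pow]
    simp only [Nat.add_sub_cancel]
    push_cast
    field_simp
    ring
  have hval : -1 / (z - lam) ^ 2 -
      ∑ i ∈ Finset.range 1, -(lam ^ (i + 1))⁻¹ * deriv (fun w : ℂ => w ^ i) z =
      -(lam ^ 2)⁻¹ * (z / lam / (1 - z / lam) ^ 2 + (1 - z / lam)⁻¹) := by
    have h1 := sub_ne_zero_of_norm_lt hl hz
    have h2 : lam - z ≠ 0 := by rw [← neg_sub]; exact neg_ne_zero.2 h1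
    simp only [one_sub_div hl0]
    rw [Finset.sum_range_one, deriv_monomial]
    simp only [Nat.cast_zero, zero_mul, mul_zero, sub_zero]
    rw [show (z - lam) ^ 2 = (lam - z) ^ 2 by ring]
    field_simp
    ring
  rw [hterm, hval]
  exact h

/-- Countable Minkowski inequality applied to the expansion of the resolvent. -/
lemma sqrt_dirInt_resolvent_le (hl : 1 < ‖lam‖)
    (hs : Summable (fun n : ℕ => Real.sqrt (dirInt (fun z : ℂ => z ^ n)) * (‖lam‖ ^ (n + 1))⁻¹)) :
    MemLp (deriv (fun w : ℂ => (w - lam)⁻¹)) 2 discMeasure ∧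
      Real.sqrt (dirInt (fun w : ℂ => (w - lam)⁻¹)) ≤
        ∑' n : ℕ, Real.sqrt (dirInt (fun z : ℂ => z ^ n)) * (‖lam‖ ^ (n + 1))⁻¹ := by
  set g : ℂ → ℂ := fun w => (w - lam)⁻¹
  set c := Real.sqrt (1 / Real.pi) with hc
  have hc0 : 0 < c := Real.sqrt_pos.2 (by positivity)
  set T := ∑' n : ℕ, Real.sqrt (dirInt (fun z : ℂ => z ^ n)) * (‖lam‖ ^ (n + 1))⁻¹
  set F : ℕ → ℂ → ℂ := fun n => (-(lam ^ (n + 1))⁻¹) • deriv (fun w : ℂ => w ^ n) with hF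
  have hFL : ∀ n, MemLp (F n) 2 discMeasure := fun n => (memLp_deriv_monomial n).const_smul _
  have hFn : ∀ n, c * lpNorm (F n) 2 discMeasure =
      Real.sqrt (dirInt (fun z : ℂ => z ^ n)) * (‖lam‖ ^ (n + 1))⁻¹ := by
    intro n
    rw [hF, sqrt_dirInt, lpNorm_const_smul]
    rw [coe_nnnorm, norm_neg, norm_inv, norm_pow]
    ring
  have hpart : ∀ N, eLpNorm (∑ n ∈ Finset.range N, F n) 2 discMeasure ≤ ENNReal.ofReal (T / c) := by
    intro N
    have hm : MemLp (∑ n ∈ Finset.range N, F n) 2 discMeasure :=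
      memLp_finsetSum' _ fun n _ => hFL n
    rw [← ofReal_lpNorm hm]
    apply ENNReal.ofReal_le_ofReal
    rw [le_div_iff₀ hc0, mul_comm]
    calc c * lpNorm (∑ n ∈ Finset.range N, F n) 2 discMeasure
        ≤ c * ∑ n ∈ Finset.range N, lpNorm (F n) 2 discMeasure := by
          gcongr
          exact lpNorm_sum_le (fun n _ => hFL n) (by norm_num)
      _ = ∑ n ∈ Finset.range N, Real.sqrt (dirInt (fun z : ℂ => z ^ n)) * (‖lam‖ ^ (n + 1))⁻¹ := by
          rw [Finset.mul_sum]
          exact Finset.sum_congr rfl fun n _ => hFn n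
      _ ≤ T := hs.sum_le_tsum _ fun n _ => by positivity
  have hlim : eLpNorm (deriv g) 2 discMeasure ≤ ENNReal.ofReal (T / c) := by
    refine Lp.eLpNorm_le_of_ae_tendsto (u := atTop) (f := fun N => ∑ n ∈ Finset.range N, F n)
      (Eventually.of_forall hpart) (fun N => (memLp_finsetSum' _ fun n _ => hFL n).1) ?_
    filter_upwards [ae_restrict_mem Metric.isOpen_ball.measurableSet] with z hz
    have := (hasSum_deriv_resolvent hl (norm_lt_one_of_mem_uDisc hz).le).tendsto_sum_nat
    simpa [hF] using this
  have hT0 : 0 ≤ T := tsum_nonneg fun n => by positivity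
  refine ⟨⟨aestronglyMeasurable_deriv_disc g, hlim.trans_lt ENNReal.ofReal_lt_top⟩, ?_⟩
  rw [sqrt_dirInt, ← hc, mul_comm, ← le_div_iff₀ hc0,
    ← toReal_eLpNorm (aestronglyMeasurable_deriv_disc g)]
  exact ENNReal.toReal_le_of_le_ofReal (by positivity) hlim

lemma MemLip.mul_resolvent {α : ℝ} (hα1 : α < 1) {f : ℂ → ℂ} (hf : MemLip α f)
    (hl : 1 < ‖lam‖) : MemLip α (fun z => f z * (z - lam)⁻¹) := by
  have hd : 0 < ‖lam‖ - 1 := by linarith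
  have hdiff : ∀ z : ℂ, ‖z‖ ≤ 1 → DifferentiableAt ℂ (fun w : ℂ => (w - lam)⁻¹) z :=
    fun z hz => (hasDerivAt_resolvent hl hz).differentiableAt
  obtain ⟨M, hM0, hM⟩ := hf.1.exists_bound
  have hA : ∀ z ∈ Metric.closedBall (0 : ℂ) 1, ‖(z - lam)⁻¹‖ ≤ (‖lam‖ - 1)⁻¹ := by
    intro z hz
    rw [norm_inv]
    exact inv_anti₀ hd (norm_sub_lower z (by simpa using hz))
  refine ⟨⟨hf.1.1.mul fun z hz =>
      (hdiff z (norm_lt_one_of_mem_uDisc hz).le).differentiableWithinAt,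
    hf.1.2.mul fun z hz => (hdiff z (by simpa using hz)).continuousAt.continuousWithinAt⟩, ?_⟩
  refine hf.2.mul_lipschitz hα1 (A := (‖lam‖ - 1)⁻¹) (L := (‖lam‖ - 1)⁻¹ * (‖lam‖ - 1)⁻¹)
    hM0 (by positivity) (by positivity) hM hA fun z hz w hw => ?_
  have h1 := sub_ne_zero_of_norm_lt hl (z := z) (by simpa using hz)
  have h2 := sub_ne_zero_of_norm_lt hl (z := w) (by simpa using hw)
  have e : (z - lam)⁻¹ - (w - lam)⁻¹ = -((z - lam)⁻¹ * (w - lam)⁻¹ * (z - w)) := by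
    field_simp
    ring
  rw [e, norm_neg, norm_mul, norm_mul]
  gcongr
  · exact hA z hz
  · exact hA w hw

end Resolvent

/-- For `f ∈ 𝒜_α` and `1 < |λ| ≤ 2`, `f/(·−λ) ∈ 𝒜_α` with
`‖f/(·−λ)‖ ≤ ‖f‖ Σₙ ‖zⁿ‖ |λ|^{−n−1} ≤ C ‖f‖/(|λ|−1)^{3/2}`. -/
theorem resolvent_bound (α : ℝ) (hα0 : 0 < α) (hα1 : α ≤ 1/2) :
    ∃ C : ℝ, 0 < C ∧ ∀ (f : ℂ → ℂ) (lam : ℂ), MemA α f → 1 < ‖lam‖ → ‖lam‖ ≤ 2 →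
      MemA α (fun z => f z / (z - lam)) ∧
      Summable (fun n : ℕ => ANorm α (fun z : ℂ => z ^ n) * ‖lam‖ ^ (-(n : ℝ) - 1)) ∧
      ANorm α (fun z => f z / (z - lam)) ≤
        ANorm α f * ∑' n : ℕ, ANorm α (fun z : ℂ => z ^ n) * ‖lam‖ ^ (-(n : ℝ) - 1) ∧
      ANorm α f * (∑' n : ℕ, ANorm α (fun z : ℂ => z ^ n) * ‖lam‖ ^ (-(n : ℝ) - 1)) ≤
        C * ANorm α f / (‖lam‖ - 1) ^ ((3 : ℝ) / 2) := by
  refine ⟨3 * 2 ^ ((3 : ℝ) / 2), by positivity, fun f lam hf hl hl2 => ?_⟩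
  have hl0 : 0 < ‖lam‖ := by linarith
  have hpow : ∀ n : ℕ, ‖lam‖ ^ (-(n : ℝ) - 1) = (‖lam‖ ^ (n + 1))⁻¹ := by
    intro n
    rw [← Real.rpow_natCast, ← Real.rpow_neg hl0.le]
    congr 1
    push_cast
    ring
  simp only [hpow]
  set p : ℕ → ℝ := fun n => (‖lam‖ ^ (n + 1))⁻¹ with hp
  have hp0 : ∀ n, 0 ≤ p n := fun n => by positivity
  have hx0 : 0 < ‖lam‖⁻¹ := by positivity
  have hx1 : ‖lam‖⁻¹ < 1 := inv_lt_one_of_one_lt₀ hl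
  obtain ⟨hs, hs3⟩ := tsum_one_add_two_sqrt_mul_pow_le hx0 hx1
  simp only [inv_pow] at hs hs3
  have hle : ∀ n : ℕ, ANorm α (fun z : ℂ => z ^ n) * p n ≤ (1 + 2 * Real.sqrt n) * p n :=
    fun n => mul_le_mul_of_nonneg_right (ANorm_monomial_le hα1 n) (hp0 n)
  have hsN : Summable (fun n : ℕ => ANorm α (fun z : ℂ => z ^ n) * p n) :=
    Summable.of_nonneg_of_le (fun n => mul_nonneg (ANorm_nonneg _ _) (hp0 n)) hle hs
  have hsup0 : ∀ n : ℕ, 0 ≤ supNorm (fun z : ℂ => z ^ n) := fun n => supNorm_nonneg _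
  have hlip0 : ∀ n : ℕ, 0 ≤ lipSemi α (fun z : ℂ => z ^ n) := fun n => lipSemi_nonneg _ _
  have hdir0 : ∀ n : ℕ, 0 ≤ Real.sqrt (dirInt (fun z : ℂ => z ^ n)) := fun n => Real.sqrt_nonneg _
  have hsA : Summable (fun n : ℕ => supNorm (fun z : ℂ => z ^ n) * p n) := by
    refine Summable.of_nonneg_of_le (fun n => mul_nonneg (hsup0 n) (hp0 n)) (fun n => ?_) hsN
    refine mul_le_mul_of_nonneg_right ?_ (hp0 n)
    rw [ANorm_eq]
    linarith [hlip0 n, hdir0 n]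
  have hsB : Summable (fun n : ℕ => lipSemi α (fun z : ℂ => z ^ n) * p n) := by
    refine Summable.of_nonneg_of_le (fun n => mul_nonneg (hlip0 n) (hp0 n)) (fun n => ?_) hsN
    refine mul_le_mul_of_nonneg_right ?_ (hp0 n)
    rw [ANorm_eq]
    linarith [hsup0 n, hdir0 n]
  have hsE : Summable (fun n : ℕ => Real.sqrt (dirInt (fun z : ℂ => z ^ n)) * p n) := by
    refine Summable.of_nonneg_of_le (fun n => mul_nonneg (hdir0 n) (hp0 n)) (fun n => ?_) hsN
    refine mul_le_mul_of_nonneg_right ?_ (hp0 n)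
    rw [ANorm_eq]
    linarith [hsup0 n, hlip0 n]
  have hsplit : ∑' n : ℕ, ANorm α (fun z : ℂ => z ^ n) * p n =
      ∑' n : ℕ, supNorm (fun z : ℂ => z ^ n) * p n
        + ∑' n : ℕ, lipSemi α (fun z : ℂ => z ^ n) * p n
        + ∑' n : ℕ, Real.sqrt (dirInt (fun z : ℂ => z ^ n)) * p n := by
    rw [← hsA.tsum_add hsB, ← (hsA.add hsB).tsum_add hsE]
    simp only [ANorm_eq, add_mul]
  have hA : ∀ z ∈ uDisc, ‖(z - lam)⁻¹‖ ≤ ∑' n : ℕ, supNorm (fun z : ℂ => z ^ n) * p n := by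
    intro z hz
    rw [← (hasSum_resolvent hl (norm_lt_one_of_mem_uDisc hz).le).tsum_eq]
    refine tsum_of_norm_bounded hsA.hasSum fun n => ?_
    rw [norm_mul, norm_neg, norm_inv, norm_pow, mul_comm]
    exact mul_le_mul_of_nonneg_right
      (le_supNorm_of_bound (fun w => norm_monomial_le_one n) hz) (hp0 n)
  have hB : ∀ z ∈ uDisc, (1 - ‖z‖) ^ (1 - α) * ‖deriv (fun w : ℂ => (w - lam)⁻¹) z‖ ≤
      ∑' n : ℕ, lipSemi α (fun z : ℂ => z ^ n) * p n := by
    intro z hz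
    have hz1 := norm_lt_one_of_mem_uDisc hz
    have hq : 0 ≤ (1 - ‖z‖) ^ (1 - α) := Real.rpow_nonneg (by linarith) _
    have h := (hasSum_deriv_resolvent hl hz1.le).mul_left (((1 - ‖z‖) ^ (1 - α) : ℝ) : ℂ)
    rw [← Complex.norm_of_nonneg hq, ← norm_mul, ← h.tsum_eq]
    refine tsum_of_norm_bounded hsB.hasSum fun n => ?_
    rw [norm_mul, norm_mul, norm_neg, norm_inv, norm_pow, Complex.norm_of_nonneg hq,
      mul_left_comm, mul_comm]
    exact mul_le_mul_of_nonneg_right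
      (le_lipSemi_of_bound (fun w => monomial_deriv_bound hα1 n) hz) (hp0 n)
  obtain ⟨hg2, hE⟩ := sqrt_dirInt_resolvent_le hl hsE
  have hgd : DifferentiableOn ℂ (fun w : ℂ => (w - lam)⁻¹) uDisc := fun z hz =>
    (hasDerivAt_resolvent hl (norm_lt_one_of_mem_uDisc hz).le).differentiableAt.differentiableWithinAt
  obtain ⟨hLp, hN⟩ := ANorm_mul_le hα0 hf hgd hg2 hA hB hE
  have hmem := hf.2.mul_resolvent (by linarith) hl
  simp only [div_eq_mul_inv (f _)]
  refine ⟨⟨⟨hmem.1.1, (memLp_deriv_iff _).1 hLp⟩, hmem⟩, hsN, ?_, ?_⟩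
  · rw [hsplit]
    exact hN
  · have hd : 0 < ‖lam‖ - 1 := by linarith
    have hR : (1 - ‖lam‖⁻¹) ^ (-(3 / 2) : ℝ) ≤
        2 ^ ((3 : ℝ) / 2) / (‖lam‖ - 1) ^ ((3 : ℝ) / 2) := by
      have e : 1 - ‖lam‖⁻¹ = (‖lam‖ - 1) / ‖lam‖ := by field_simp
      rw [e, Real.rpow_neg (by positivity), Real.div_rpow hd.le hl0.le, inv_div]
      gcongr
    calc ANorm α f * ∑' n : ℕ, ANorm α (fun z : ℂ => z ^ n) * p n
        ≤ ANorm α f * (3 * (2 ^ ((3 : ℝ) / 2) / (‖lam‖ - 1) ^ ((3 : ℝ) / 2))) := by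
          refine mul_le_mul_of_nonneg_left ?_ (ANorm_nonneg α f)
          exact (hsN.tsum_le_tsum hle hs).trans (hs3.trans (by gcongr))
      _ = _ := by ring
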